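/- Let f(x) = (1 − x)^α (1 + x)^β g(x) with α, β ≥ 0 not both integers and g infinitely differentiable on [−1,1]. Define s = 2 min{α, β} if neither α nor β is an integer, s = 2α if β is an integer, and s = 2β if α is an integer. Then the error of the (n+1)-point Clenshaw–Curtis quadrature rule applied to ∫_{−1}^{1} f(x) dx satisfies E_n^C[f] = O(n^{−s−2}) as n → ∞. -/

import Mathlib

open Real Filter Finset

/-- The Chebyshev coefficients of `f : [-1,1] → ℝ`:
`a_k = (2/π) ∫_0^π f(cos t) cos(kt) dt`. -/
noncomputable def chebCoeff (f : ℝ → ℝ) (k : ℕ) : ℝ :=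
  (2 / π) * ∫ t in (0 : ℝ)..π, f (Real.cos t) * Real.cos ((k : ℝ) * t)

/-- `δ_j = 1/2` if `j = 0` or `j = n`, and `δ_j = 1` otherwise. -/
noncomputable def ccDelta (n j : ℕ) : ℝ := if j = 0 ∨ j = n then 1 / 2 else 1

/-- The Clenshaw–Curtis quadrature weights
`w_j = (4δ_j/n) Σ_{k=0}^{⌊n/2⌋} δ_{2k} cos(2jkπ/n)/(1−4k²)`. -/
noncomputable def ccWeight (n j : ℕ) : ℝ :=
  (4 * ccDelta n j / (n : ℝ)) * ∑ k ∈ Finset.range (n / 2 + 1),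
    ccDelta n (2 * k) * Real.cos (2 * (j : ℝ) * (k : ℝ) * π / (n : ℝ)) / (1 - 4 * (k : ℝ) ^ 2)

/-- The `(n+1)`-point Clenshaw–Curtis quadrature rule
`I_n^C[f] = Σ_{j=0}^{n} w_j f(cos(jπ/n))`. -/
noncomputable def ccQuad (f : ℝ → ℝ) (n : ℕ) : ℝ :=
  ∑ j ∈ Finset.range (n + 1), ccWeight n j * f (Real.cos ((j : ℝ) * π / (n : ℝ)))

/-- The Clenshaw–Curtis quadrature error `E_n^C[f] = ∫_{-1}^1 f − I_n^C[f]`. -/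
noncomputable def ccError (f : ℝ → ℝ) (n : ℕ) : ℝ :=
  (∫ x in (-1 : ℝ)..1, f x) - ccQuad f n

/-- The function `t ↦ sin^γ t (1 + cos t)^c g(cos t)`. -/
noncomputable def jacobiTrig (γ c : ℝ) (g : ℝ → ℝ) (t : ℝ) : ℝ :=
  Real.sin t ^ γ * (1 + Real.cos t) ^ c * g (Real.cos t)

/-- The smooth factor of the derivative of `jacobiTrig γ c g`. -/
noncomputable def jacobiTrigStep (γ c : ℝ) (g : ℝ → ℝ) (x : ℝ) : ℝ :=
  γ * x * g x - c * (1 - x) * g x - (1 - x ^ 2) * derivWithin g (Set.Icc (-1) 1) x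

theorem contDiffOn_jacobiTrigStep (γ c : ℝ) {g : ℝ → ℝ}
    (hg : ContDiffOn ℝ (⊤ : ℕ∞) g (Set.Icc (-1) 1)) :
    ContDiffOn ℝ (⊤ : ℕ∞) (jacobiTrigStep γ c g) (Set.Icc (-1) 1) := by
  have h1 : ContDiffOn ℝ (⊤ : ℕ∞) (derivWithin g (Set.Icc (-1) 1)) (Set.Icc (-1) 1) :=
    hg.derivWithin (uniqueDiffOn_Icc (by norm_num)) (by simp)
  unfold jacobiTrigStep
  fun_prop

theorem hasDerivAt_jacobiTrig (γ c : ℝ) {g : ℝ → ℝ}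
    (hg : ContDiffOn ℝ (⊤ : ℕ∞) g (Set.Icc (-1) 1)) {t : ℝ} (ht : t ∈ Set.Ioo 0 π) :
    HasDerivAt (jacobiTrig γ c g) (jacobiTrig (γ - 1) c (jacobiTrigStep γ c g) t) t := by
  have hs : 0 < Real.sin t := sin_pos_of_mem_Ioo ht
  have hsc := Real.sin_sq_add_cos_sq t
  have hc1 : 0 < 1 + Real.cos t := by nlinarith [Real.neg_one_le_cos t]
  have hc2 : 0 < 1 - Real.cos t := by nlinarith [Real.cos_le_one t]
  have hmem : Set.Icc (-1 : ℝ) 1 ∈ nhds (Real.cos t) :=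
    Icc_mem_nhds (by linarith) (by linarith)
  have hgd : HasDerivAt g (derivWithin g (Set.Icc (-1) 1) (Real.cos t)) (Real.cos t) :=
    ((hg.differentiableOn (by simp) _ (mem_of_mem_nhds hmem)).hasDerivWithinAt).hasDerivAt hmem
  have h1 := (Real.hasDerivAt_sin t).rpow_const (p := γ) (Or.inl hs.ne')
  have h2 := ((Real.hasDerivAt_cos t).const_add 1).rpow_const (p := c) (Or.inl hc1.ne')
  have h3 := hgd.comp t (Real.hasDerivAt_cos t)
  convert! (h1.mul h2).mul h3 using 1
  simp only [jacobiTrig, jacobiTrigStep, Function.comp, Pi.mul_apply]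
  rw [Real.rpow_sub_one hs.ne', Real.rpow_sub_one hc1.ne']
  have h4 : 1 - Real.cos t ^ 2 = Real.sin t ^ 2 := by linarith
  have h5 : Real.sin t ^ 2 = (1 - Real.cos t) * (1 + Real.cos t) := by linarith
  rw [h4]
  field_simp
  rw [h5]
  ring

theorem continuousOn_jacobiTrig (γ c : ℝ) {g : ℝ → ℝ}
    (hg : ContDiffOn ℝ (⊤ : ℕ∞) g (Set.Icc (-1) 1)) :
    ContinuousOn (jacobiTrig γ c g) (Set.Ioo 0 π) :=
  fun _ ht => (hasDerivAt_jacobiTrig γ c hg ht).continuousAt.continuousWithinAt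

theorem continuous_jacobiTrig {γ c : ℝ} (hγ : 0 ≤ γ) (hc : 0 ≤ c) {g : ℝ → ℝ}
    (hg : ContDiffOn ℝ (⊤ : ℕ∞) g (Set.Icc (-1) 1)) :
    Continuous (jacobiTrig γ c g) := by
  have h1 : Continuous fun t : ℝ => g (Real.cos t) :=
    hg.continuousOn.comp_continuous Real.continuous_cos
      fun t => ⟨Real.neg_one_le_cos t, Real.cos_le_one t⟩
  unfold jacobiTrig
  exact ((Real.continuous_sin.rpow_const fun _ => Or.inr hγ).mul
    ((continuous_const.add Real.continuous_cos).rpow_const fun _ => Or.inr hc)).mul h1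

theorem exists_abs_jacobiTrig_le (γ : ℝ) {c : ℝ} (hc : 0 ≤ c) {g : ℝ → ℝ}
    (hg : ContDiffOn ℝ (⊤ : ℕ∞) g (Set.Icc (-1) 1)) :
    ∃ K, 0 ≤ K ∧ ∀ t ∈ Set.Icc 0 π, |jacobiTrig γ c g t| ≤ K * Real.sin t ^ γ := by
  obtain ⟨B, hB⟩ := isCompact_Icc.exists_bound_of_continuousOn hg.continuousOn
  have hB0 : 0 ≤ B := (norm_nonneg _).trans (hB 0 (by norm_num))
  refine ⟨2 ^ c * B, by positivity, fun t ht => ?_⟩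
  have hs := Real.sin_nonneg_of_mem_Icc ht
  have hc1 : 0 ≤ 1 + Real.cos t := by linarith [Real.neg_one_le_cos t]
  have hb := hB (Real.cos t) ⟨Real.neg_one_le_cos t, Real.cos_le_one t⟩
  have hp : (1 + Real.cos t) ^ c ≤ 2 ^ c :=
    Real.rpow_le_rpow hc1 (by linarith [Real.cos_le_one t]) hc
  rw [jacobiTrig, abs_mul, abs_mul, abs_of_nonneg (Real.rpow_nonneg hs _),
    abs_of_nonneg (Real.rpow_nonneg hc1 _), mul_assoc, mul_comm (Real.sin t ^ γ)]
  gcongr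
  exact hb

theorem sin_rpow_le {γ : ℝ} (hγ : γ ≤ 0) {t : ℝ} (h0 : 0 < t) (h1 : t ≤ π / 2) :
    Real.sin t ^ γ ≤ (2 / π) ^ γ * t ^ γ := by
  rw [← Real.mul_rpow (by positivity) h0.le]
  exact Real.rpow_le_rpow_of_nonpos (by positivity) (Real.mul_le_sin h0.le h1) hγ

theorem sin_rpow_le_add {γ : ℝ} (hγ : γ ≤ 0) {t : ℝ} (ht : t ∈ Set.Ioo 0 π) :
    Real.sin t ^ γ ≤ (2 / π) ^ γ * (t ^ γ + (π - t) ^ γ) := by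
  have ha : 0 ≤ t ^ γ := Real.rpow_nonneg ht.1.le _
  have hb : 0 ≤ (π - t) ^ γ := Real.rpow_nonneg (by linarith [ht.2]) _
  have hp : 0 ≤ (2 / π) ^ γ := by positivity
  rcases le_total t (π / 2) with h | h
  · exact (sin_rpow_le hγ ht.1 h).trans (by gcongr; linarith)
  · rw [← Real.sin_pi_sub]
    exact (sin_rpow_le hγ (by linarith [ht.2]) (by linarith)).trans (by gcongr; linarith)

theorem intervalIntegrable_jacobiTrig {γ c : ℝ} (hγ : -1 < γ) (hc : 0 ≤ c) {g : ℝ → ℝ}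
    (hg : ContDiffOn ℝ (⊤ : ℕ∞) g (Set.Icc (-1) 1)) :
    IntervalIntegrable (jacobiTrig γ c g) MeasureTheory.volume 0 π := by
  rcases le_total 0 γ with h | h
  · exact (continuous_jacobiTrig h hc hg).intervalIntegrable _ _
  obtain ⟨K, hK0, hK⟩ := exists_abs_jacobiTrig_le γ hc hg
  have h1 : IntervalIntegrable (fun t : ℝ => t ^ γ) MeasureTheory.volume 0 π :=
    intervalIntegral.intervalIntegrable_rpow' hγ
  have h2 : IntervalIntegrable (fun t : ℝ => (π - t) ^ γ) MeasureTheory.volume 0 π := by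
    have := h1.comp_sub_left π
    simpa using this.symm
  have h3 := ((h1.add h2).const_mul ((2 / π) ^ γ)).const_mul K
  rw [intervalIntegrable_iff_integrableOn_Ioo_of_le pi_pos.le] at h3 ⊢
  refine MeasureTheory.Integrable.mono' h3
    ((continuousOn_jacobiTrig γ c hg).aestronglyMeasurable measurableSet_Ioo) ?_
  refine (MeasureTheory.ae_restrict_iff' measurableSet_Ioo).2 (Eventually.of_forall fun t ht => ?_)
  exact (hK t (Set.Ioo_subset_Icc_self ht)).trans (by gcongr; exact sin_rpow_le_add h ht)

theorem abs_integral_mul_cos_le_by_parts {F F' : ℝ → ℝ} {a b : ℝ} (hab : a ≤ b)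
    (hF : ContinuousOn F (Set.Icc a b)) (hd : ∀ t ∈ Set.Ioo a b, HasDerivAt F (F' t) t)
    (hi : IntervalIntegrable F' MeasureTheory.volume a b) (θ : ℝ) {m : ℝ} (hm : 0 < m) :
    |∫ t in a..b, F t * Real.cos (m * t + θ)| ≤
      (|F a| + |F b|) / m + |∫ t in a..b, F' t * Real.cos (m * t + (θ - π / 2))| / m := by
  have hv : ∀ t : ℝ, HasDerivAt (fun t => Real.sin (m * t + θ) / m) (Real.cos (m * t + θ)) t := by
    intro t
    have := (((hasDerivAt_id t).const_mul m).add_const θ).sin.div_const m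
    simpa [hm.ne'] using this
  have key := intervalIntegral.integral_mul_deriv_eq_deriv_mul_of_hasDerivAt (u := F) (u' := F')
    (v := fun t => Real.sin (m * t + θ) / m) (v' := fun t => Real.cos (m * t + θ)) (a := a) (b := b)
    (by rwa [Set.uIcc_of_le hab]) (by fun_prop)
    (by rw [min_eq_left hab, max_eq_right hab]; exact hd) (fun t _ => hv t) hi
    (Continuous.intervalIntegrable (by fun_prop) _ _)
  have h2 : ∫ t in a..b, F' t * (Real.sin (m * t + θ) / m) =
      (∫ t in a..b, F' t * Real.cos (m * t + (θ - π / 2))) / m := by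
    rw [← intervalIntegral.integral_div]
    refine intervalIntegral.integral_congr fun t _ => ?_
    simp only [← add_sub_assoc, Real.cos_sub_pi_div_two]
    ring
  rw [key, h2]
  have hs : ∀ x y : ℝ, |y * (Real.sin x / m)| ≤ |y| / m := fun x y => by
    rw [← mul_div_assoc, abs_div, abs_of_pos hm, abs_mul]
    gcongr
    exact mul_le_of_le_one_right (abs_nonneg _) (Real.abs_sin_le_one _)
  refine (abs_sub _ _).trans ?_
  rw [abs_div _ m, abs_of_pos hm, add_div]
  gcongr
  refine (abs_sub _ _).trans ?_
  linarith [hs (m * a + θ) (F a), hs (m * b + θ) (F b)]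

theorem abs_integral_zero_mul_cos_le {F : ℝ → ℝ} {γ K : ℝ} (hγ : -1 < γ) (hγ0 : γ ≤ 0)
    (hK0 : 0 ≤ K) (hK : ∀ t ∈ Set.Ioc 0 1, |F t| ≤ K * Real.sin t ^ γ)
    {δ : ℝ} (hδ0 : 0 < δ) (hδ1 : δ ≤ 1) {φ : ℝ → ℝ} (hφ : ∀ t, |φ t| ≤ 1) :
    |∫ t in (0 : ℝ)..δ, F t * φ t| ≤ K * (2 / π) ^ γ / (γ + 1) * δ ^ (γ + 1) := by
  have h1 : IntervalIntegrable (fun t : ℝ => t ^ γ) MeasureTheory.volume 0 δ :=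
    intervalIntegral.intervalIntegrable_rpow' hγ
  have h2 := intervalIntegral.norm_integral_le_of_norm_le (f := fun t => F t * φ t)
    (g := fun t => K * (2 / π) ^ γ * t ^ γ) (a := 0) (b := δ) (μ := MeasureTheory.volume) hδ0.le
    (Eventually.of_forall fun t ht => by
      rw [norm_mul, Real.norm_eq_abs, Real.norm_eq_abs]
      have hb := hK t ⟨ht.1, ht.2.trans hδ1⟩
      have hs := sin_rpow_le hγ0 ht.1
        ((ht.2.trans hδ1).trans (by linarith [Real.pi_gt_three]))
      calc |F t| * |φ t| ≤ |F t| := mul_le_of_le_one_right (abs_nonneg _) (hφ t)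
        _ ≤ K * Real.sin t ^ γ := hb
        _ ≤ K * ((2 / π) ^ γ * t ^ γ) := by gcongr
        _ = _ := by ring) (h1.const_mul _)
  rw [Real.norm_eq_abs] at h2
  refine h2.trans (le_of_eq ?_)
  rw [intervalIntegral.integral_const_mul, integral_rpow (Or.inl hγ),
    Real.zero_rpow (by linarith), sub_zero]
  ring

theorem abs_integral_pi_mul_cos_le {F : ℝ → ℝ} {γ K : ℝ} (hγ : -1 < γ) (hγ0 : γ ≤ 0)
    (hK0 : 0 ≤ K) (hK : ∀ t ∈ Set.Icc 0 π, |F t| ≤ K * Real.sin t ^ γ)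
    {δ : ℝ} (hδ0 : 0 < δ) (hδ1 : δ ≤ 1) {φ : ℝ → ℝ} (hφ : ∀ t, |φ t| ≤ 1) :
    |∫ t in (π - δ)..π, F t * φ t| ≤ K * (2 / π) ^ γ / (γ + 1) * δ ^ (γ + 1) := by
  have h := abs_integral_zero_mul_cos_le (F := fun t => F (π - t)) (φ := fun t => φ (π - t))
    hγ hγ0 hK0 (fun t ht => by
      rw [← Real.sin_pi_sub]
      exact hK _ ⟨by linarith [ht.2, Real.pi_gt_three], by linarith [ht.1]⟩) hδ0 hδ1
    (fun t => hφ _)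
  have h2 := intervalIntegral.integral_comp_sub_left (fun t => F t * φ t) π (a := 0) (b := δ)
  rw [sub_zero] at h2
  rwa [h2] at h

theorem abs_integral_middle_le {F : ℝ → ℝ} {γ K : ℝ} (hγ : γ < -1)
    (hK0 : 0 ≤ K) (hK : ∀ t ∈ Set.Icc 0 π, |F t| ≤ K * Real.sin t ^ γ)
    {δ : ℝ} (hδ0 : 0 < δ) (hδ1 : δ ≤ 1) {φ : ℝ → ℝ} (hφ : ∀ t, |φ t| ≤ 1) :
    |∫ t in δ..(π - δ), F t * φ t| ≤ 2 * K * (2 / π) ^ γ / (-γ - 1) * δ ^ (γ + 1) := by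
  have hπ := Real.pi_gt_three
  have hle : δ ≤ π - δ := by linarith
  have h0 : (0 : ℝ) ∉ Set.uIcc δ (π - δ) := by
    rw [Set.uIcc_of_le hle]
    exact fun h => absurd h.1 (by linarith)
  have h1 : IntervalIntegrable (fun t : ℝ => t ^ γ) MeasureTheory.volume δ (π - δ) :=
    intervalIntegral.intervalIntegrable_rpow (Or.inr h0)
  have h2 : IntervalIntegrable (fun t : ℝ => (π - t) ^ γ) MeasureTheory.volume δ (π - δ) := by
    have := h1.comp_sub_left π
    simpa using this.symm
  have h3 := intervalIntegral.norm_integral_le_of_norm_le (f := fun t => F t * φ t)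
    (g := fun t => K * (2 / π) ^ γ * (t ^ γ + (π - t) ^ γ)) (a := δ) (b := π - δ)
    (μ := MeasureTheory.volume) hle
    (Eventually.of_forall fun t ht => by
      rw [norm_mul, Real.norm_eq_abs, Real.norm_eq_abs]
      have ht' : t ∈ Set.Ioo 0 π := ⟨by linarith [ht.1], by linarith [ht.2]⟩
      have hb := hK t (Set.Ioo_subset_Icc_self ht')
      have hs := sin_rpow_le_add (by linarith : γ ≤ 0) ht'
      calc |F t| * |φ t| ≤ |F t| := mul_le_of_le_one_right (abs_nonneg _) (hφ t)
        _ ≤ K * Real.sin t ^ γ := hb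
        _ ≤ K * ((2 / π) ^ γ * (t ^ γ + (π - t) ^ γ)) := by gcongr
        _ = _ := by ring) ((h1.add h2).const_mul _)
  rw [Real.norm_eq_abs] at h3
  refine h3.trans ?_
  have h4 := intervalIntegral.integral_comp_sub_left (fun t : ℝ => t ^ γ) π (a := δ) (b := π - δ)
  rw [sub_sub_cancel] at h4
  rw [intervalIntegral.integral_const_mul, intervalIntegral.integral_add h1 h2, h4,
    integral_rpow (Or.inr ⟨by linarith, h0⟩)]
  have h5 : ((π - δ) ^ (γ + 1) - δ ^ (γ + 1)) / (γ + 1) ≤ δ ^ (γ + 1) / (-γ - 1) := by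
    have : 0 ≤ (π - δ) ^ (γ + 1) := Real.rpow_nonneg (by linarith) _
    rw [show (γ + 1) = -(-γ - 1) by ring, div_neg, ← neg_div]
    gcongr
    · linarith
    · rw [show -(-γ - 1) = γ + 1 by ring]; linarith
  calc _ ≤ K * (2 / π) ^ γ * (δ ^ (γ + 1) / (-γ - 1) + δ ^ (γ + 1) / (-γ - 1)) := by gcongr
    _ = _ := by ring

/-- Decay of the oscillatory integrals of `sin^γ (1 + cos)^c g(cos)` in the integrable singular
range `-1 < γ ≤ 0`. -/
theorem exists_abs_integral_jacobiTrig_le_of_nonpos {γ c : ℝ} (hγ : -1 < γ) (hγ0 : γ ≤ 0)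
    (hc : 0 ≤ c) {g : ℝ → ℝ} (hg : ContDiffOn ℝ (⊤ : ℕ∞) g (Set.Icc (-1) 1)) :
    ∃ C, ∀ θ m : ℝ, 1 ≤ m →
      |∫ t in (0 : ℝ)..π, jacobiTrig γ c g t * Real.cos (m * t + θ)| ≤ C * m ^ (-γ - 1) := by
  have hg1 := contDiffOn_jacobiTrigStep γ c hg
  have hg2 := contDiffOn_jacobiTrigStep (γ - 1) c hg1
  obtain ⟨K0, hK00, hK0⟩ := exists_abs_jacobiTrig_le γ hc hg
  obtain ⟨K1, hK10, hK1⟩ := exists_abs_jacobiTrig_le (γ - 1) hc hg1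
  obtain ⟨K2, hK20, hK2⟩ := exists_abs_jacobiTrig_le (γ - 1 - 1) hc hg2
  refine ⟨2 * (K0 * (2 / π) ^ γ / (γ + 1)) + 2 * (K0 * (2 / π) ^ γ) +
    2 * (K1 * (2 / π) ^ (γ - 1)) +
    2 * K2 * (2 / π) ^ (γ - 1 - 1) / (-(γ - 1 - 1) - 1), fun θ m hm => ?_⟩
  have hm0 : 0 < m := by linarith
  set δ : ℝ := m⁻¹ with hδ
  have hδ0 : 0 < δ := inv_pos.2 hm0
  have hδ1 : δ ≤ 1 := inv_le_one_of_one_le₀ hm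
  have hπ := Real.pi_gt_three
  have hle : δ ≤ π - δ := by linarith
  have hsub : Set.Icc δ (π - δ) ⊆ Set.Ioo 0 π := fun t ht => ⟨by linarith [ht.1], by linarith [ht.2]⟩
  have hcos : ∀ η t : ℝ, |Real.cos (m * t + η)| ≤ 1 := fun η t => Real.abs_cos_le_one _
  have hint : ∀ γ' : ℝ, ∀ h : ℝ → ℝ, ContDiffOn ℝ (⊤ : ℕ∞) h (Set.Icc (-1) 1) →
      IntervalIntegrable (jacobiTrig γ' c h) MeasureTheory.volume δ (π - δ) := fun γ' h hh =>
    ContinuousOn.intervalIntegrable_of_Icc hle ((continuousOn_jacobiTrig γ' c hh).mono hsub)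
  have hend : ∀ γ' K : ℝ, γ' ≤ 0 → 0 ≤ K → ∀ h : ℝ → ℝ,
      (∀ t ∈ Set.Icc 0 π, |jacobiTrig γ' c h t| ≤ K * Real.sin t ^ γ') →
      |jacobiTrig γ' c h δ| + |jacobiTrig γ' c h (π - δ)| ≤ 2 * (K * (2 / π) ^ γ') * δ ^ γ' := by
    intro γ' K hγ' hK h hh
    have e1 := hh δ ⟨by linarith, by linarith⟩
    have e2 := hh (π - δ) ⟨by linarith, by linarith⟩
    rw [Real.sin_pi_sub] at e2
    have e3 := mul_le_mul_of_nonneg_left (sin_rpow_le hγ' hδ0 (by linarith)) hK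
    linarith
  have b1 := abs_integral_mul_cos_le_by_parts hle ((continuousOn_jacobiTrig γ c hg).mono hsub)
    (fun t ht => hasDerivAt_jacobiTrig γ c hg (hsub (Set.Ioo_subset_Icc_self ht)))
    (hint _ _ hg1) θ hm0
  have b2 := abs_integral_mul_cos_le_by_parts hle
    ((continuousOn_jacobiTrig (γ - 1) c hg1).mono hsub)
    (fun t ht => hasDerivAt_jacobiTrig (γ - 1) c hg1 (hsub (Set.Ioo_subset_Icc_self ht)))
    (hint _ _ hg2) (θ - π / 2) hm0
  have e1 := hend γ K0 hγ0 hK00 g hK0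
  have e2 := hend (γ - 1) K1 (by linarith) hK10 _ hK1
  have c1 := abs_integral_zero_mul_cos_le hγ hγ0 hK00
    (fun t ht => hK0 t ⟨ht.1.le, by linarith [ht.2]⟩) hδ0 hδ1 (hcos θ)
  have c2 := abs_integral_pi_mul_cos_le hγ hγ0 hK00 hK0 hδ0 hδ1 (hcos θ)
  have c3 := abs_integral_middle_le (by linarith : γ - 1 - 1 < -1) hK20 hK2 hδ0 hδ1
    (hcos (θ - π / 2 - π / 2))
  have hfull := (intervalIntegrable_jacobiTrig hγ hc hg).mul_continuousOn
    (g := fun t => Real.cos (m * t + θ)) (by fun_prop)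
  have hIab : ∀ a b : ℝ, a ∈ Set.Icc 0 π → b ∈ Set.Icc 0 π →
      IntervalIntegrable (fun t => jacobiTrig γ c g t * Real.cos (m * t + θ))
        MeasureTheory.volume a b := fun a b ha hb =>
    hfull.mono_set (by
      rw [Set.uIcc_of_le pi_pos.le]
      exact Set.uIcc_subset_Icc ha hb)
  have m0 : (0 : ℝ) ∈ Set.Icc 0 π := ⟨le_rfl, pi_pos.le⟩
  have m1 : δ ∈ Set.Icc 0 π := ⟨by linarith, by linarith⟩
  have m2 : π - δ ∈ Set.Icc 0 π := ⟨by linarith, by linarith⟩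
  have m3 : π ∈ Set.Icc 0 π := ⟨pi_pos.le, le_rfl⟩
  rw [← intervalIntegral.integral_add_adjacent_intervals (hIab 0 (π - δ) m0 m2)
      (hIab (π - δ) π m2 m3),
    ← intervalIntegral.integral_add_adjacent_intervals (hIab 0 δ m0 m1) (hIab δ (π - δ) m1 m2)]
  refine (abs_add_three _ _ _).trans ?_
  have hP : m ^ (-γ - 1) = δ ^ (γ + 1) := by
    rw [hδ, Real.inv_rpow hm0.le, ← Real.rpow_neg hm0.le]; congr 1; ring
  have r1 : δ ^ γ * δ = δ ^ (γ + 1) := by rw [Real.rpow_add_one hδ0.ne']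
  have r2 : δ ^ (γ - 1) * δ = δ ^ γ := by rw [← Real.rpow_add_one hδ0.ne']; congr 1; ring
  have r3 : δ ^ (γ - 1 - 1 + 1) = δ ^ (γ - 1) := by congr 1; ring
  rw [hP]
  have hdm : ∀ x : ℝ, x / m = x * δ := fun x => div_eq_mul_inv x m
  simp only [hdm] at b1 b2
  rw [r3] at c3
  have f1 := mul_le_mul_of_nonneg_right e1 hδ0.le
  have f2 := mul_le_mul_of_nonneg_right (mul_le_mul_of_nonneg_right e2 hδ0.le) hδ0.le
  have f3 := mul_le_mul_of_nonneg_right (mul_le_mul_of_nonneg_right c3 hδ0.le) hδ0.le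
  have f4 := mul_le_mul_of_nonneg_right b2 hδ0.le
  have s1 : ∀ A : ℝ, A * δ ^ γ * δ = A * δ ^ (γ + 1) := fun A => by rw [mul_assoc, r1]
  have s2 : ∀ A : ℝ, A * δ ^ (γ - 1) * δ * δ = A * δ ^ (γ + 1) := fun A => by
    rw [mul_assoc A, r2, s1]
  rw [s1] at f1
  rw [s2] at f2 f3
  linarith

/-- Decay of the oscillatory integrals of `sin^γ (1 + cos)^c g(cos)`. -/
theorem exists_abs_integral_jacobiTrig_le (N : ℕ) : ∀ {γ c : ℝ}, -1 < γ → γ ≤ N → 0 ≤ c →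
    ∀ {g : ℝ → ℝ}, ContDiffOn ℝ (⊤ : ℕ∞) g (Set.Icc (-1) 1) →
    ∃ C, ∀ θ m : ℝ, 1 ≤ m →
      |∫ t in (0 : ℝ)..π, jacobiTrig γ c g t * Real.cos (m * t + θ)| ≤ C * m ^ (-γ - 1) := by
  induction N with
  | zero =>
    intro γ c hγ hγ0 hc g hg
    exact exists_abs_integral_jacobiTrig_le_of_nonpos hγ (by simpa using hγ0) hc hg
  | succ N ih =>
    intro γ c hγ hγN hc g hg
    rcases le_or_gt γ 0 with h0 | h0
    · exact exists_abs_integral_jacobiTrig_le_of_nonpos hγ h0 hc hg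
    have hg1 := contDiffOn_jacobiTrigStep γ c hg
    obtain ⟨C, hC⟩ := ih (γ := γ - 1) (by linarith) (by push_cast at hγN; linarith) hc hg1
    refine ⟨C, fun θ m hm => ?_⟩
    have hm0 : 0 < m := by linarith
    have b := abs_integral_mul_cos_le_by_parts pi_pos.le
      (continuous_jacobiTrig h0.le hc hg).continuousOn
      (fun t ht => hasDerivAt_jacobiTrig γ c hg ht)
      (intervalIntegrable_jacobiTrig (by linarith : -1 < γ - 1) hc hg1) θ hm0
    have z1 : jacobiTrig γ c g 0 = 0 := by simp [jacobiTrig, Real.zero_rpow h0.ne']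
    have z2 : jacobiTrig γ c g π = 0 := by simp [jacobiTrig, Real.zero_rpow h0.ne']
    rw [z1, z2, abs_zero, add_zero, zero_div, zero_add] at b
    refine b.trans ?_
    rw [Real.rpow_sub_one hm0.ne', ← mul_div_assoc]
    gcongr
    exact (hC _ m hm).trans (le_of_eq (by ring_nf))

/-- The integrals `∫_0^π f(cos t) cos(mt) dt`, proportional to the Chebyshev coefficients. -/
noncomputable def cosCoeff (f : ℝ → ℝ) (m : ℤ) : ℝ :=
  ∫ t in (0 : ℝ)..π, f (Real.cos t) * Real.cos (m * t)

theorem abs_cosCoeff_comp_neg (f : ℝ → ℝ) (m : ℤ) :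
    |cosCoeff (fun x => f (-x)) m| = |cosCoeff f m| := by
  have h := intervalIntegral.integral_comp_sub_left
    (fun t => f (-Real.cos t) * Real.cos (m * t)) π (a := 0) (b := π)
  rw [sub_zero, sub_self] at h
  unfold cosCoeff
  rw [← h]
  have h2 : ∀ t : ℝ, f (-Real.cos (π - t)) * Real.cos (m * (π - t)) =
      (-1) ^ m * (f (Real.cos t) * Real.cos (m * t)) := fun t => by
    rw [Real.cos_pi_sub, neg_neg, mul_sub, Real.cos_int_mul_pi_sub]
    ring
  simp only [h2]
  rw [intervalIntegral.integral_const_mul, abs_mul, abs_zpow, abs_neg, abs_one, one_zpow, one_mul]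

theorem exists_abs_integral_algebraic_le {α β : ℝ} (hα : 0 ≤ α) (hαβ : α ≤ β) {g : ℝ → ℝ}
    (hg : ContDiffOn ℝ (⊤ : ℕ∞) g (Set.Icc (-1) 1)) :
    ∃ C, ∀ m : ℝ, 1 ≤ m →
      |∫ t in (0 : ℝ)..π, (1 - Real.cos t) ^ α * (1 + Real.cos t) ^ β * g (Real.cos t) *
        Real.cos (m * t)| ≤ C * m ^ (-(2 * α) - 1) := by
  obtain ⟨N, hN⟩ := exists_nat_ge (2 * α)
  obtain ⟨C, hC⟩ := exists_abs_integral_jacobiTrig_le N (γ := 2 * α) (c := β - α)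
    (by linarith) hN (by linarith) hg
  refine ⟨C, fun m hm => ?_⟩
  convert hC 0 m hm using 2
  refine intervalIntegral.integral_congr fun t ht => ?_
  rw [Set.uIcc_of_le pi_pos.le] at ht
  have h1 : 0 ≤ 1 - Real.cos t := by linarith [Real.cos_le_one t]
  have h2 : 0 ≤ 1 + Real.cos t := by linarith [Real.neg_one_le_cos t]
  have h3 : Real.sin t ^ (2 * α) = (1 - Real.cos t) ^ α * (1 + Real.cos t) ^ α := by
    rw [Real.rpow_mul (Real.sin_nonneg_of_mem_Icc ht), ← Real.mul_rpow h1 h2]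
    congr 1
    rw [Real.rpow_two]
    linarith [Real.sin_sq_add_cos_sq t]
  have h4 : (1 + Real.cos t) ^ β = (1 + Real.cos t) ^ α * (1 + Real.cos t) ^ (β - α) := by
    rw [← Real.rpow_add_of_nonneg h2 hα (by linarith)]
    congr 1; ring
  simp only [jacobiTrig, h3, h4, add_zero]
  ring

theorem integral_comp_cos_two_mul {f : ℝ → ℝ} (hf : ContinuousOn f (Set.Icc (-1) 1)) (m : ℤ) :
    ∫ t in (0 : ℝ)..π, f (Real.cos t) * Real.cos (m * t) =
      ∫ t in (0 : ℝ)..π, f (Real.cos (2 * t)) * Real.cos (m * (2 * t)) := by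
  set F : ℝ → ℝ := fun t => f (Real.cos t) * Real.cos (m * t) with hF
  have hcont : Continuous F :=
    (hf.comp_continuous Real.continuous_cos
      fun t => ⟨Real.neg_one_le_cos t, Real.cos_le_one t⟩).mul (by fun_prop)
  have hrefl : ∀ t, F (2 * π - t) = F t := fun t => by
    simp only [hF]
    rw [Real.cos_two_pi_sub, show (m : ℝ) * (2 * π - t) = m * (2 * π) - m * t by ring,
      Real.cos_int_mul_two_pi_sub]
  have h1 := intervalIntegral.integral_comp_sub_left F (2 * π) (a := 0) (b := π)
  simp only [hrefl, sub_zero] at h1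
  rw [show 2 * π - π = π by ring] at h1
  have h2 := intervalIntegral.integral_comp_mul_left F (c := 2) (a := 0) (b := π) two_ne_zero
  have h3 := intervalIntegral.integral_add_adjacent_intervals
    (hcont.intervalIntegrable (μ := MeasureTheory.volume) 0 π) (hcont.intervalIntegrable π (2 * π))
  rw [← h1] at h3
  rw [mul_zero, ← h3] at h2
  refine Eq.trans ?_ h2.symm
  rw [smul_eq_mul]; ring

theorem exists_abs_integral_one_sub_rpow_le {α : ℝ} (hα : 0 ≤ α) {g : ℝ → ℝ}
    (hg : ContDiffOn ℝ (⊤ : ℕ∞) g (Set.Icc (-1) 1)) :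
    ∃ C, ∀ m : ℤ, 1 ≤ m →
      |cosCoeff (fun x => (1 - x) ^ α * g x) m| ≤ C * (m : ℝ) ^ (-(2 * α) - 1) := by
  have hg' : ContDiffOn ℝ (⊤ : ℕ∞) (fun y : ℝ => 2 ^ α * g (2 * y ^ 2 - 1)) (Set.Icc (-1) 1) := by
    refine ContDiffOn.mul contDiffOn_const (hg.comp (t := Set.Icc (-1 : ℝ) 1) (by fun_prop) fun y hy => ?_)
    constructor <;> nlinarith [hy.1, hy.2]
  obtain ⟨C, hC⟩ := exists_abs_integral_algebraic_le hα le_rfl hg'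
  refine ⟨C * 2 ^ (-(2 * α) - 1), fun m hm => ?_⟩
  have hm' : (1 : ℝ) ≤ m := by exact_mod_cast hm
  have hcont : ContinuousOn (fun x : ℝ => (1 - x) ^ α * g x) (Set.Icc (-1) 1) :=
    ((continuous_const.sub continuous_id).rpow_const fun _ => Or.inr hα).continuousOn.mul
      hg.continuousOn
  rw [cosCoeff, integral_comp_cos_two_mul hcont, mul_assoc C,
    ← Real.mul_rpow zero_le_two (by linarith)]
  convert hC (2 * m) (by linarith) using 2
  refine intervalIntegral.integral_congr fun t _ => ?_
  have h1 : 0 ≤ 1 - Real.cos t := by linarith [Real.cos_le_one t]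
  have h2 : 0 ≤ 1 + Real.cos t := by linarith [Real.neg_one_le_cos t]
  have h3 : 1 - Real.cos (2 * t) = 2 * ((1 - Real.cos t) * (1 + Real.cos t)) := by
    rw [Real.cos_two_mul]; ring
  have h4 : (m : ℝ) * (2 * t) = 2 * m * t := by ring
  simp only [h3, h4]
  rw [Real.mul_rpow zero_le_two (mul_nonneg h1 h2), Real.mul_rpow h1 h2, Real.cos_two_mul]
  ring

theorem contDiffOn_one_add_rpow_mul {β : ℝ} (hβ : 0 ≤ β) (hint : ∃ i : ℤ, β = (i : ℝ))
    {g : ℝ → ℝ} (hg : ContDiffOn ℝ (⊤ : ℕ∞) g (Set.Icc (-1) 1)) :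
    ContDiffOn ℝ (⊤ : ℕ∞) (fun x : ℝ => (1 + x) ^ β * g x) (Set.Icc (-1) 1) := by
  obtain ⟨i, rfl⟩ := hint
  lift i to ℕ using by exact_mod_cast hβ
  simp only [Int.cast_natCast, Real.rpow_natCast]
  fun_prop

theorem contDiffOn_comp_neg {g : ℝ → ℝ} (hg : ContDiffOn ℝ (⊤ : ℕ∞) g (Set.Icc (-1) 1)) :
    ContDiffOn ℝ (⊤ : ℕ∞) (fun x => g (-x)) (Set.Icc (-1) 1) :=
  hg.comp (t := Set.Icc (-1 : ℝ) 1) (by fun_prop)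
    fun x hx => ⟨by linarith [hx.2], by linarith [hx.1]⟩

/-- The Chebyshev coefficients of `(1 - x)^α (1 + x)^β g(x)` decay like `m^(-s-1)`. -/
theorem exists_abs_cosCoeff_le {α β : ℝ} (hα : 0 ≤ α) (hβ : 0 ≤ β) {g : ℝ → ℝ}
    (hg : ContDiffOn ℝ (⊤ : ℕ∞) g (Set.Icc (-1) 1)) {s : ℝ}
    (hs1 : (¬(∃ i : ℤ, α = (i : ℝ)) ∧ ¬(∃ i : ℤ, β = (i : ℝ))) → s = 2 * min α β)
    (hs2 : (∃ i : ℤ, β = (i : ℝ)) → s = 2 * α)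
    (hs3 : (∃ i : ℤ, α = (i : ℝ)) → s = 2 * β) :
    ∃ C, ∀ m : ℤ, 1 ≤ m →
      |cosCoeff (fun x => (1 - x) ^ α * (1 + x) ^ β * g x) m| ≤ C * (m : ℝ) ^ (-s - 1) := by
  have hrefl : ∀ m, |cosCoeff (fun x => (1 - x) ^ α * (1 + x) ^ β * g x) m| =
      |cosCoeff (fun x => (1 - x) ^ β * (1 + x) ^ α * g (-x)) m| := fun m => by
    rw [← abs_cosCoeff_comp_neg]
    congr 2
    funext x
    rw [sub_neg_eq_add, ← sub_eq_add_neg]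
    ring
  have hcast : ∀ {m : ℤ}, 1 ≤ m → (1 : ℝ) ≤ m := fun h => by exact_mod_cast h
  by_cases hb : ∃ i : ℤ, β = (i : ℝ)
  · rw [hs2 hb]
    simpa only [mul_assoc] using
      exists_abs_integral_one_sub_rpow_le hα (contDiffOn_one_add_rpow_mul hβ hb hg)
  by_cases ha : ∃ i : ℤ, α = (i : ℝ)
  · rw [hs3 ha]
    simp only [hrefl]
    simpa only [mul_assoc] using exists_abs_integral_one_sub_rpow_le hβ
      (contDiffOn_one_add_rpow_mul hα ha (contDiffOn_comp_neg hg))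
  rw [hs1 ⟨ha, hb⟩]
  rcases le_total α β with h | h
  · obtain ⟨C, hC⟩ := exists_abs_integral_algebraic_le hα h hg
    rw [min_eq_left h]
    exact ⟨C, fun m hm => hC m (hcast hm)⟩
  · obtain ⟨C, hC⟩ := exists_abs_integral_algebraic_le hβ h (contDiffOn_comp_neg hg)
    rw [min_eq_right h]
    exact ⟨C, fun m hm => (hrefl m).trans_le (hC m (hcast hm))⟩

theorem sum_ccDelta_mul {n : ℕ} (hn : 1 ≤ n) (x : ℕ → ℝ) :
    ∑ j ∈ Finset.range (n + 1), ccDelta n j * x j =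
      (∑ j ∈ Finset.range n, (x j + x (j + 1))) / 2 := by
  obtain ⟨p, rfl⟩ := Nat.exists_eq_add_of_le' hn
  rw [Finset.sum_add_distrib, Finset.sum_range_succ, Finset.sum_range_succ',
    Finset.sum_range_succ' (fun j => x j), Finset.sum_range_succ (fun j => x (j + 1))]
  have h : ∀ j ∈ Finset.range p, ccDelta (p + 1) (j + 1) * x (j + 1) = x (j + 1) := by
    intro j hj
    rw [Finset.mem_range] at hj
    rw [ccDelta, if_neg (by omega), one_mul]
  rw [Finset.sum_congr rfl h]
  simp only [ccDelta, true_or, or_true, if_true]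
  ring

theorem sum_ccDelta_mul_cos {n : ℕ} (hn : 1 ≤ n) (c : ℤ) :
    ∑ j ∈ Finset.range (n + 1), ccDelta n j * Real.cos (c * (j * π / n)) =
      if (2 * n : ℤ) ∣ c then (n : ℝ) else 0 := by
  have hn0 : (n : ℝ) ≠ 0 := by positivity
  split_ifs with h
  · obtain ⟨q, rfl⟩ := h
    have h1 : ∀ j : ℕ, Real.cos (((2 * n * q : ℤ) : ℝ) * (j * π / n)) = 1 := fun j => by
      rw [show ((2 * n * q : ℤ) : ℝ) * (j * π / n) = ((q * j : ℤ) : ℝ) * (2 * π) by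
        push_cast; field_simp]
      exact Real.cos_int_mul_two_pi _
    simp only [h1]
    rw [sum_ccDelta_mul hn fun _ => 1]
    simp
  · rw [sum_ccDelta_mul hn fun j => Real.cos (c * (j * π / n))]
    have hsin : Real.sin (c * π / (2 * n)) ≠ 0 := by
      rw [Real.sin_ne_zero_iff]
      intro q hq
      apply h
      refine ⟨q, ?_⟩
      have : (c : ℝ) = 2 * n * q := by
        field_simp at hq
        linarith
      exact_mod_cast this
    have hterm : ∀ j : ℕ, (Real.cos (c * (j * π / n)) + Real.cos (c * ((j + 1 : ℕ) * π / n))) *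
        Real.sin (c * π / (2 * n)) = Real.cos (c * π / (2 * n)) *
        (Real.sin (c * ((j + 1 : ℕ) * π / n)) - Real.sin (c * (j * π / n))) := fun j => by
      have e1 : (c : ℝ) * (j * π / n) = (c * j * π / n + c * π / (2 * n)) - c * π / (2 * n) := by
        ring
      have e2 : (c : ℝ) * ((j + 1 : ℕ) * π / n) =
          (c * j * π / n + c * π / (2 * n)) + c * π / (2 * n) := by
        push_cast; field_simp; ring
      rw [e1, e2]
      generalize (c : ℝ) * j * π / n + c * π / (2 * n) = x
      generalize (c : ℝ) * π / (2 * n) = y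
      rw [Real.cos_sub, Real.cos_add, Real.sin_add, Real.sin_sub]
      ring
    have htel : (∑ j ∈ Finset.range n, (Real.cos (c * (j * π / n)) +
        Real.cos (c * ((j + 1 : ℕ) * π / n)))) * Real.sin (c * π / (2 * n)) = 0 := by
      rw [Finset.sum_mul, Finset.sum_congr rfl fun j _ => hterm j, ← Finset.mul_sum,
        Finset.sum_range_sub fun j : ℕ => Real.sin (c * (j * π / n))]
      rw [show (c : ℝ) * (n * π / n) = c * π by field_simp, Real.sin_int_mul_pi]
      simp
    rw [(mul_eq_zero.1 htel).resolve_right hsin, zero_div]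

theorem ccDelta_mul_sum_cos_mul_cos {n a k : ℕ} (hn : 1 ≤ n) (ha : a ≤ n) (hk : k ≤ n) :
    ccDelta n a * ∑ j ∈ Finset.range (n + 1), ccDelta n j *
      (Real.cos (a * (j * π / n)) * Real.cos (k * (j * π / n))) =
      if a = k then (n : ℝ) / 2 else 0 := by
  have h : ∀ j : ℕ, ccDelta n j * (Real.cos (a * (j * π / n)) * Real.cos (k * (j * π / n))) =
      (ccDelta n j * Real.cos (((a - k : ℤ) : ℝ) * (j * π / n)) +
        ccDelta n j * Real.cos (((a + k : ℤ) : ℝ) * (j * π / n))) / 2 := fun j => by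
    push_cast
    rw [sub_mul, add_mul, Real.cos_sub, Real.cos_add]
    ring
  simp only [h]
  rw [← Finset.sum_div, Finset.sum_add_distrib, sum_ccDelta_mul_cos hn, sum_ccDelta_mul_cos hn]
  have h1 : (2 * n : ℤ) ∣ (a - k : ℤ) ↔ a = k := by
    constructor
    · intro hd
      have := Int.eq_zero_of_abs_lt_dvd hd (by rw [abs_lt]; omega)
      omega
    · rintro rfl; simp
  have h2 : (2 * n : ℤ) ∣ (a + k : ℤ) ↔ a = k ∧ (a = 0 ∨ a = n) := by
    constructor
    · rintro ⟨q, hq⟩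
      rcases lt_trichotomy q 1 with h | h | h
      · have : q ≤ 0 := by omega
        have : (2 * n : ℤ) * q ≤ 0 := mul_nonpos_of_nonneg_of_nonpos (by omega) this
        omega
      · subst h; omega
      · have : (2 * n : ℤ) * 2 ≤ 2 * n * q := mul_le_mul_of_nonneg_left (by omega) (by omega)
        omega
    · rintro ⟨rfl, rfl | rfl⟩
      · simp
      · exact ⟨1, by ring⟩
  simp only [h1, h2, ccDelta]
  by_cases e : a = k <;> by_cases e' : a = 0 ∨ a = n <;> simp [e, e'] <;> simp_all
  ring

/-- The moments `∫_0^π cos(mt) sin t dt`. -/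
noncomputable def sinMoment (m : ℤ) : ℝ := if Even m then 2 / (1 - (m : ℝ) ^ 2) else 0

/-- The value of the Clenshaw–Curtis rule at the Chebyshev polynomial `T_m`. -/
noncomputable def ccMoment (n : ℕ) (m : ℤ) : ℝ :=
  ∑ j ∈ Finset.range (n + 1), ccWeight n j * Real.cos (m * (j * π / n))

theorem ccMoment_natCast {n k : ℕ} (hn : 1 ≤ n) (hk : k ≤ n) :
    ccMoment n k = sinMoment k := by
  have hn0 : (n : ℝ) ≠ 0 := by positivity
  have h1 : ccMoment n k = ∑ l ∈ Finset.range (n / 2 + 1), 4 / n / (1 - 4 * (l : ℝ) ^ 2) *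
      (if 2 * l = k then (n : ℝ) / 2 else 0) := by
    simp only [ccMoment, ccWeight, Int.cast_natCast]
    simp only [Finset.mul_sum, Finset.sum_mul]
    rw [Finset.sum_comm]
    refine Finset.sum_congr rfl fun l hl => ?_
    rw [Finset.mem_range] at hl
    rw [← ccDelta_mul_sum_cos_mul_cos hn (by omega) hk, Finset.mul_sum, Finset.mul_sum]
    refine Finset.sum_congr rfl fun j _ => ?_
    rw [show (2 : ℝ) * j * l * π / n = ((2 * l : ℕ) : ℝ) * (j * π / n) by push_cast; ring]
    ring
  rw [h1, sinMoment]
  split_ifs with he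
  · obtain ⟨l, hl⟩ := (Int.even_coe_nat k).1 he
    rw [Finset.sum_eq_single_of_mem l (Finset.mem_range.2 (by omega)) fun b _ hb => by
      rw [if_neg (by omega), mul_zero], if_pos (by omega)]
    subst hl
    push_cast
    rw [show (1 : ℝ) - (l + l) ^ 2 = 1 - 4 * (l : ℝ) ^ 2 by ring]
    field_simp
    norm_num
  · refine Finset.sum_eq_zero fun l _ => ?_
    rw [if_neg, mul_zero]
    rintro rfl
    exact he (by simp)

theorem sinMoment_neg (m : ℤ) : sinMoment (-m) = sinMoment m := by
  simp [sinMoment]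

theorem ccMoment_neg (n : ℕ) (m : ℤ) : ccMoment n (-m) = ccMoment n m := by
  simp [ccMoment]

theorem ccMoment_of_abs_le {n : ℕ} (hn : 1 ≤ n) {k : ℤ} (hk : |k| ≤ n) :
    ccMoment n k = sinMoment k := by
  rcases Int.eq_nat_or_neg k with ⟨l, rfl | rfl⟩
  · exact ccMoment_natCast hn (by simpa using hk)
  · rw [ccMoment_neg, sinMoment_neg]
    exact ccMoment_natCast hn (by simpa using hk)

theorem ccMoment_periodic {n : ℕ} (hn : 1 ≤ n) (p k : ℤ) :
    ccMoment n (2 * n * p + k) = ccMoment n k := by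
  have hn0 : (n : ℝ) ≠ 0 := by positivity
  refine Finset.sum_congr rfl fun j _ => ?_
  congr 1
  rw [show ((2 * n * p + k : ℤ) : ℝ) * (j * π / n) = k * (j * π / n) + ((p * j : ℤ) : ℝ) * (2 * π) by
    push_cast; field_simp; ring]
  exact Real.cos_add_int_mul_two_pi _ _

theorem sq_sub_one_ge {m : ℤ} (he : Even m) (h0 : m ≠ 0) : (m : ℝ) ^ 2 / 2 ≤ (m : ℝ) ^ 2 - 1 := by
  have h : (2 : ℤ) ≤ |m| := by
    obtain ⟨l, rfl⟩ := he
    have : 1 ≤ |l| := Int.one_le_abs (by omega)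
    rw [← two_mul, abs_mul]
    norm_num
    exact this
  have h2 : (2 : ℝ) ≤ |(m : ℝ)| := by exact_mod_cast h
  have : (4 : ℝ) ≤ (m : ℝ) ^ 2 := by rw [← sq_abs]; nlinarith
  linarith

theorem abs_sinMoment_mul_sq_le (m : ℤ) : |sinMoment m| * (m : ℝ) ^ 2 ≤ 4 := by
  rw [sinMoment]
  split_ifs with he
  · rcases eq_or_ne m 0 with rfl | h0
    · simp
    have h := sq_sub_one_ge he h0
    have hm : 0 < (m : ℝ) ^ 2 := by positivity
    rw [abs_div, abs_sub_comm, abs_of_pos (by linarith : 0 < (m : ℝ) ^ 2 - 1), abs_two,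
      div_mul_eq_mul_div, div_le_iff₀ (by linarith)]
    linarith
  · simp

theorem integral_cos_mul_sin (m : ℤ) :
    ∫ t in (0 : ℝ)..π, Real.cos (m * t) * Real.sin t = sinMoment m := by
  have h1 : ∀ t : ℝ, Real.cos (m * t) * Real.sin t =
      (Real.sin (((m + 1 : ℤ) : ℝ) * t) - Real.sin (((m - 1 : ℤ) : ℝ) * t)) / 2 := fun t => by
    push_cast
    rw [add_mul, sub_mul, one_mul, Real.sin_add, Real.sin_sub]
    ring
  have h2 : ∀ c : ℤ, ∫ t in (0 : ℝ)..π, Real.sin ((c : ℝ) * t) = (1 - (-1) ^ c) / c := fun c => by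
    rcases eq_or_ne c 0 with rfl | hc
    · simp
    have hc' : (c : ℝ) ≠ 0 := by exact_mod_cast hc
    have := intervalIntegral.integral_comp_mul_left Real.sin (c := (c : ℝ)) (a := 0) (b := π) hc'
    rw [this, integral_sin, mul_zero, Real.cos_zero, Real.cos_int_mul_pi, smul_eq_mul]
    field_simp
  simp only [h1]
  rw [intervalIntegral.integral_div, intervalIntegral.integral_sub
    (Continuous.intervalIntegrable (by fun_prop) _ _)
    (Continuous.intervalIntegrable (by fun_prop) _ _), h2, h2, sinMoment]
  split_ifs with he
  · have hp : Odd (m + 1) := he.add_one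
    have hm : Odd (m - 1) := he.sub_odd odd_one
    rw [hp.neg_one_zpow, hm.neg_one_zpow]
    have e1 : ((m + 1 : ℤ) : ℝ) ≠ 0 := by
      norm_cast; rintro h; rw [h] at hp; exact absurd hp (by decide)
    have e2 : ((m - 1 : ℤ) : ℝ) ≠ 0 := by
      norm_cast; rintro h; rw [h] at hm; exact absurd hm (by decide)
    have e3 : (1 : ℝ) - (m : ℝ) ^ 2 ≠ 0 := by
      have : (1 : ℝ) - (m : ℝ) ^ 2 = -(((m + 1 : ℤ) : ℝ) * ((m - 1 : ℤ) : ℝ)) := by push_cast; ring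
      rw [this]; exact neg_ne_zero.2 (mul_ne_zero e1 e2)
    push_cast at e1 e2 ⊢
    field_simp
    ring
  · rw [Int.not_even_iff_odd] at he
    rw [(he.add_one).neg_one_zpow, (he.sub_odd odd_one).neg_one_zpow]
    simp

theorem fourierCoeff_comp_angle_cos {f : ℝ → ℝ} (hf : ContinuousOn f (Set.Icc (-1) 1)) (m : ℤ) :
    haveI : Fact (0 < 2 * π) := ⟨two_pi_pos⟩
    fourierCoeff (T := 2 * π) (fun x => ((f (Real.Angle.cos x) : ℝ) : ℂ)) m =
      ((cosCoeff f m / π : ℝ) : ℂ) := by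
  have : Fact (0 < 2 * π) := ⟨two_pi_pos⟩
  have hF : Continuous fun t : ℝ => f (Real.cos t) :=
    hf.comp_continuous Real.continuous_cos
      fun t => ⟨Real.neg_one_le_cos t, Real.cos_le_one t⟩
  set G : ℝ → ℂ := fun x => Complex.exp (-(m * x * Complex.I)) * (f (Real.cos x) : ℂ) with hG
  have hGc : Continuous G :=
    (show Continuous fun x : ℝ => Complex.exp (-(m * x * Complex.I)) by fun_prop).mul
      (Complex.continuous_ofReal.comp hF)
  rw [fourierCoeff_eq_intervalIntegral _ _ (-π), show -π + 2 * π = π by ring]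
  have h1 : ∀ x : ℝ, fourier (T := 2 * π) (-m) (x : AddCircle (2 * π)) •
      ((f (Real.Angle.cos (x : Real.Angle)) : ℝ) : ℂ) = G x := fun x => by
    rw [fourier_coe_apply, Real.Angle.cos_coe, smul_eq_mul, hG]
    congr 2
    push_cast
    field_simp
  have h2 : ∀ x : ℝ, G (-x) + G x = ((2 * (f (Real.cos x) * Real.cos (m * x)) : ℝ) : ℂ) :=
    fun x => by
      simp only [hG, Real.cos_neg]
      push_cast
      rw [Complex.cos]
      ring_nf
  have h3 : ∫ x in (-π)..π, G x = ((2 * cosCoeff f m : ℝ) : ℂ) := by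
    rw [← intervalIntegral.integral_add_adjacent_intervals (b := 0)
      (hGc.intervalIntegrable _ _) (hGc.intervalIntegrable _ _)]
    have h4 := intervalIntegral.integral_comp_neg (f := G) (a := 0) (b := π)
    rw [neg_zero] at h4
    rw [← h4, ← intervalIntegral.integral_add
      ((show Continuous fun x => G (-x) from hGc.comp continuous_neg).intervalIntegrable _ _) (hGc.intervalIntegrable _ _)]
    simp only [h2]
    rw [intervalIntegral.integral_ofReal, intervalIntegral.integral_const_mul, cosCoeff]
  calc _ = (1 / (2 * π)) • ∫ x in (-π)..π, G x := by
        congr 1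
        exact intervalIntegral.integral_congr fun x _ => h1 x
    _ = _ := by
        rw [h3, Complex.real_smul]
        push_cast
        field_simp

/-- Pointwise convergence of the Chebyshev series, indexed by the integers. -/
theorem hasSum_cosCoeff_mul_cos {f : ℝ → ℝ} (hf : ContinuousOn f (Set.Icc (-1) 1))
    (hs : Summable (cosCoeff f)) (t : ℝ) :
    HasSum (fun m : ℤ => cosCoeff f m / π * Real.cos (m * t)) (f (Real.cos t)) := by
  have : Fact (0 < 2 * π) := ⟨two_pi_pos⟩
  have hc : Continuous fun x : AddCircle (2 * π) => ((f (Real.Angle.cos x) : ℝ) : ℂ) :=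
    Complex.continuous_ofReal.comp (hf.comp_continuous Real.Angle.continuous_cos fun x => by
      induction x using Real.Angle.induction_on with
      | _ x => exact ⟨Real.neg_one_le_cos x, Real.cos_le_one x⟩)
  have hco := fourierCoeff_comp_angle_cos hf
  have hsum : Summable (fourierCoeff (T := 2 * π)
      (fun x => ((f (Real.Angle.cos x) : ℝ) : ℂ))) := by
    rw [funext hco]
    exact Complex.summable_ofReal.2 (hs.div_const π)
  have h := has_pointwise_sum_fourier_series_of_summable (f := ⟨_, hc⟩) hsum
    (t : AddCircle (2 * π))
  have h2 := Complex.hasSum_re h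
  convert! h2 using 1
  funext m
  rw [ContinuousMap.coe_mk, hco, fourier_coe_apply, smul_eq_mul, Complex.re_ofReal_mul,
    show (2 * π * Complex.I * m * t / ((2 * π : ℝ) : ℂ) : ℂ) = ((m * t : ℝ) : ℂ) * Complex.I by
      push_cast; field_simp, Complex.exp_ofReal_mul_I_re]

theorem integral_eq_integral_comp_cos_mul_sin {f : ℝ → ℝ}
    (hf : ContinuousOn f (Set.Icc (-1) 1)) :
    ∫ x in (-1 : ℝ)..1, f x = ∫ t in (0 : ℝ)..π, f (Real.cos t) * Real.sin t := by
  have h := intervalIntegral.integral_comp_mul_deriv'' (f := Real.cos) (g := f)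
    (f' := fun t => -Real.sin t) (a := 0) (b := π) (by fun_prop)
    (fun x _ => (Real.hasDerivAt_cos x).hasDerivWithinAt) (by fun_prop)
    (hf.mono (by
      rintro _ ⟨t, _, rfl⟩
      exact ⟨Real.neg_one_le_cos t, Real.cos_le_one t⟩))
  rw [Real.cos_zero, Real.cos_pi, intervalIntegral.integral_symm (-1) 1] at h
  simp only [Function.comp, mul_neg, intervalIntegral.integral_neg] at h
  linarith

/-- The Clenshaw–Curtis error as a series in the Chebyshev coefficients. -/
theorem hasSum_ccError {f : ℝ → ℝ} (hf : ContinuousOn f (Set.Icc (-1) 1))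
    (hs : Summable (cosCoeff f)) (n : ℕ) :
    HasSum (fun m : ℤ => cosCoeff f m / π * (sinMoment m - ccMoment n m)) (ccError f n) := by
  have hpt := hasSum_cosCoeff_mul_cos hf hs
  have hI : HasSum (fun m : ℤ => cosCoeff f m / π * sinMoment m) (∫ x in (-1 : ℝ)..1, f x) := by
    rw [integral_eq_integral_comp_cos_mul_sin hf]
    have h := intervalIntegral.hasSum_integral_of_dominated_convergence
      (μ := MeasureTheory.volume) (a := 0) (b := π)
      (F := fun (m : ℤ) t => cosCoeff f m / π * (Real.cos (m * t) * Real.sin t))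
      (f := fun t => f (Real.cos t) * Real.sin t)
      (fun m _ => ‖cosCoeff f m / π‖)
      (fun m => Continuous.aestronglyMeasurable (by fun_prop))
      (fun m => Eventually.of_forall fun t _ => by
        rw [norm_mul, norm_mul, Real.norm_eq_abs (Real.cos _), Real.norm_eq_abs (Real.sin _)]
        exact mul_le_of_le_one_right (norm_nonneg _)
          (mul_le_one₀ (Real.abs_cos_le_one _) (abs_nonneg _) (Real.abs_sin_le_one _)))
      (Eventually.of_forall fun t _ => (hs.div_const π).norm)
      (by simp)
      (Eventually.of_forall fun t _ => by
        simpa only [mul_assoc] using (hpt t).mul_right (Real.sin t))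
    simpa only [intervalIntegral.integral_const_mul, integral_cos_mul_sin] using h
  have hQ : HasSum (fun m : ℤ => cosCoeff f m / π * ccMoment n m) (ccQuad f n) := by
    have h := hasSum_sum (s := Finset.range (n + 1)) fun j _ =>
      (hpt ((j : ℝ) * π / n)).mul_left (ccWeight n j)
    convert! h using 1
    funext m
    rw [ccMoment, Finset.mul_sum]
    exact Finset.sum_congr rfl fun j _ => by ring
  simpa only [mul_sub] using! hI.sub hQ

theorem sum_Ioo_sinMoment_eq {n : ℕ} (hn : 1 ≤ n) :
    ∑ k ∈ Finset.Ioo (-(n : ℤ)) n, sinMoment k = 2 / (if Odd n then (n : ℝ) else n - 1) := by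
  induction n, hn using Nat.le_induction with
  | base =>
    rw [show Finset.Ioo (-((1 : ℕ) : ℤ)) (1 : ℕ) = {0} by decide]
    simp [sinMoment]
  | succ n hn ih =>
    have hset : Finset.Ioo (-((n + 1 : ℕ) : ℤ)) ((n + 1 : ℕ) : ℤ) =
        insert (n : ℤ) (insert (-(n : ℤ)) (Finset.Ioo (-(n : ℤ)) n)) := by
      ext k
      simp only [Finset.mem_insert, Finset.mem_Ioo]
      omega
    rw [hset, Finset.sum_insert (by simp; omega), Finset.sum_insert (by simp), ih, sinMoment_neg,
      sinMoment]
    rcases Nat.even_or_odd n with he | ho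
    · have h2 : (2 : ℝ) ≤ n := by
        have : 2 ≤ n := by
          obtain ⟨l, rfl⟩ := he
          omega
        exact_mod_cast this
      rw [if_pos ((Int.even_coe_nat n).2 he), if_neg (Nat.not_odd_iff_even.2 he),
        if_pos he.add_one]
      have e1 : (n : ℝ) - 1 ≠ 0 := by linarith
      have e2 : (n : ℝ) + 1 ≠ 0 := by linarith
      have e3 : (1 : ℝ) - (n : ℝ) ^ 2 ≠ 0 := by nlinarith
      push_cast
      field_simp
      ring
    · rw [if_neg (by rw [Int.even_coe_nat]; exact Nat.not_even_iff_odd.2 ho), if_pos ho,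
        if_neg (Nat.not_odd_iff_even.2 ho.add_one)]
      simp

theorem abs_sum_Ioo_sinMoment_le {n : ℕ} (hn : 1 ≤ n) :
    |∑ k ∈ Finset.Ioo (-(n : ℤ)) n, sinMoment k| ≤ 4 / n := by
  have hn1 : (1 : ℝ) ≤ n := by exact_mod_cast hn
  rw [sum_Ioo_sinMoment_eq hn]
  split_ifs with h
  · rw [abs_of_nonneg (by positivity)]
    gcongr
    norm_num
  · have h2 : (2 : ℝ) ≤ n := by
      have : 2 ≤ n := by
        rcases hn.eq_or_lt with rfl | h'
        · exact absurd odd_one h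
        · exact h'
      exact_mod_cast this
    rw [abs_of_nonneg (div_nonneg zero_le_two (by linarith)), div_le_div_iff₀ (by linarith)
      (by linarith)]
    linarith

theorem abs_second_difference_le {a : ℤ → ℝ} {M : ℤ} {n : ℕ} {η : ℝ}
    (h : ∀ m, M - n ≤ m → |a (m + 2) - 2 * a m + a (m - 2)| ≤ η) (j : ℕ) (hj : 2 * j ≤ n) :
    |a (M + 2 * j) + a (M - 2 * j) - 2 * a M| ≤ (j : ℝ) ^ 2 * η := by
  suffices H : ∀ j : ℕ, 2 * j ≤ n → |a (M + 2 * j) + a (M - 2 * j) - 2 * a M| ≤ (j : ℝ) ^ 2 * η ∧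
      |(a (M + 2 * j + 2) + a (M - 2 * j - 2)) - (a (M + 2 * j) + a (M - 2 * j))| ≤
        (2 * j + 1) * η from (H j hj).1
  intro j
  induction j with
  | zero =>
    intro _
    have h0 := h M (by omega)
    refine ⟨?_, ?_⟩
    · simp [two_mul]
    · simp only [Nat.cast_zero, mul_zero, add_zero, sub_zero, zero_add, one_mul]
      convert h0 using 2
      ring
  | succ j ih =>
    intro hj
    obtain ⟨i1, i2⟩ := ih (by omega)
    have h1 := h (M + 2 * j + 2) (by omega)
    have h2 := h (M - 2 * j - 2) (by omega)
    rw [show M + 2 * (j : ℤ) + 2 - 2 = M + 2 * j by ring] at h1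
    rw [show M - 2 * (j : ℤ) - 2 + 2 = M - 2 * j by ring] at h2
    rw [show M + 2 * ((j + 1 : ℕ) : ℤ) = M + 2 * j + 2 by push_cast; ring,
      show M - 2 * ((j + 1 : ℕ) : ℤ) = M - 2 * j - 2 by push_cast; ring]
    push_cast
    rw [abs_le] at h1 h2 i1 i2
    refine ⟨abs_le.2 ⟨?_, ?_⟩, abs_le.2 ⟨?_, ?_⟩⟩ <;>
      linarith [i1.1, i1.2, i2.1, i2.2, h1.1, h1.2, h2.1, h2.2]

theorem abs_sinMoment_mul_second_difference_le {a : ℤ → ℝ} {M : ℤ} {n : ℕ} {η : ℝ}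
    (h : ∀ m, M - n ≤ m → |a (m + 2) - 2 * a m + a (m - 2)| ≤ η) {k : ℤ} (hk : |k| ≤ n) :
    |sinMoment k * (a (M + k) + a (M - k) - 2 * a M)| ≤ 4 * η := by
  have hη : 0 ≤ η := (abs_nonneg _).trans (h M (by omega))
  have key : ∀ l : ℕ, l ≤ n →
      |sinMoment l * (a (M + l) + a (M - l) - 2 * a M)| ≤ 4 * η := by
    intro l hl
    by_cases he : Even (l : ℤ)
    · obtain ⟨j, hj⟩ := (Int.even_coe_nat l).1 he
      have h1 := abs_second_difference_le h j (by omega)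
      have h2 := abs_sinMoment_mul_sq_le l
      rw [show (l : ℤ) = 2 * j by omega] at h2 ⊢
      rw [abs_mul]
      calc _ ≤ |sinMoment (2 * j)| * ((j : ℝ) ^ 2 * η) := by gcongr
        _ ≤ |sinMoment (2 * j)| * (((2 * j : ℤ) : ℝ) ^ 2 * η) := by
          gcongr
          push_cast
          nlinarith [sq_nonneg (j : ℝ)]
        _ = (|sinMoment (2 * j)| * ((2 * j : ℤ) : ℝ) ^ 2) * η := by ring
        _ ≤ 4 * η := by gcongr
    · rw [sinMoment, if_neg he, zero_mul, abs_zero]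
      positivity
  rcases Int.eq_nat_or_neg k with ⟨l, rfl | rfl⟩
  · exact key l (by simpa using hk)
  · rw [sinMoment_neg, sub_neg_eq_add, ← sub_eq_add_neg, add_comm (a (M - l))]
    exact key l (by simpa using hk)

theorem sum_Ioo_neg_comm (n : ℕ) (h : ℤ → ℝ) :
    ∑ k ∈ Finset.Ioo (-(n : ℤ)) n, h (-k) = ∑ k ∈ Finset.Ioo (-(n : ℤ)) n, h k :=
  Finset.sum_equiv (Equiv.neg ℤ) (fun k => by
    simp only [Finset.mem_Ioo, Equiv.neg_apply]; omega) fun _ _ => rfl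

theorem sum_range_two_mul_sub (n : ℕ) (h : ℤ → ℝ) :
    ∑ i ∈ Finset.range (2 * n), h (i - n) = ∑ k ∈ Finset.Ico (-(n : ℤ)) n, h k :=
  Finset.sum_nbij' (fun i => (i : ℤ) - n) (fun k => (k + n).toNat)
    (fun i hi => by simp only [Finset.mem_range, Finset.mem_Ico] at *; omega)
    (fun k hk => by simp only [Finset.mem_range, Finset.mem_Ico] at *; omega)
    (fun i _ => by simp)
    (fun k hk => by simp only [Finset.mem_Ico] at *; omega)
    (fun _ _ => rfl)

/-- The contribution to the aliasing error of the frequencies within `n` of `2np`. -/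
theorem abs_sum_block_le {a : ℤ → ℝ} {C D σ : ℝ} (hσ : 0 < σ)
    (ha : ∀ m : ℤ, 1 ≤ m → |a m| ≤ C * (m : ℝ) ^ (-σ - 1))
    (hd : ∀ m : ℤ, 1 ≤ m → |a (m + 2) - 2 * a m + a (m - 2)| ≤ D * (m : ℝ) ^ (-σ - 3))
    {n p : ℕ} (hn : 1 ≤ n) (hp : 1 ≤ p) :
    |∑ k ∈ Finset.Ico (-(n : ℤ)) n,
      a (2 * n * p + k) * (sinMoment (2 * n * p + k) - ccMoment n (2 * n * p + k))| ≤
      (16 * C + 4 * D) * ((p : ℝ) ^ (-σ - 1) * (n : ℝ) ^ (-σ - 2)) := by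
  have hn1 : (1 : ℝ) ≤ n := by exact_mod_cast hn
  have hp1 : (1 : ℝ) ≤ p := by exact_mod_cast hp
  have hn0 : (0 : ℝ) < n := by linarith
  have hp0 : (0 : ℝ) < p := by linarith
  have hC : 0 ≤ C := by simpa using (abs_nonneg _).trans (ha 1 le_rfl)
  have hD : 0 ≤ D := by simpa using (abs_nonneg _).trans (hd 1 le_rfl)
  set M : ℤ := 2 * n * p with hM
  set x : ℝ := p * n with hx
  have hx0 : 0 < x := by positivity
  have hpn : (n : ℤ) ≤ p * n := by exact_mod_cast Nat.le_mul_of_pos_left n hp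
  have hlow : ∀ m : ℤ, M - n ≤ m → 1 ≤ m ∧ x ≤ (m : ℝ) := fun m hm => by
    have h1 : (p * n : ℤ) ≤ m := by
      have : M = p * n + p * n := by rw [hM]; ring
      omega
    refine ⟨by omega, ?_⟩
    rw [hx]
    exact_mod_cast h1
  set A : ℝ := C * x ^ (-σ - 1)
  set η : ℝ := D * x ^ (-σ - 3)
  have hA0 : 0 ≤ A := by positivity
  have hA : ∀ m : ℤ, M - n ≤ m → |a m| ≤ A := fun m hm => by
    obtain ⟨h1, h2⟩ := hlow m hm
    exact (ha m h1).trans (mul_le_mul_of_nonneg_left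
      (Real.rpow_le_rpow_of_nonpos hx0 h2 (by linarith)) hC)
  have hη : ∀ m : ℤ, M - n ≤ m → |a (m + 2) - 2 * a m + a (m - 2)| ≤ η := fun m hm => by
    obtain ⟨h1, h2⟩ := hlow m hm
    exact (hd m h1).trans (mul_le_mul_of_nonneg_left
      (Real.rpow_le_rpow_of_nonpos hx0 h2 (by linarith)) hD)
  have hlam : ∀ m : ℤ, M - n ≤ m → |sinMoment m| ≤ 4 / x ^ 2 := fun m hm => by
    obtain ⟨_, h2⟩ := hlow m hm
    rw [le_div_iff₀ (by positivity)]
    refine le_trans ?_ (abs_sinMoment_mul_sq_le m)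
    gcongr
  have hsplit : ∑ k ∈ Finset.Ico (-(n : ℤ)) n,
      a (M + k) * (sinMoment (M + k) - ccMoment n (M + k)) =
      ∑ k ∈ Finset.Ico (-(n : ℤ)) n, a (M + k) * sinMoment (M + k) -
      (a (M + -n) * sinMoment (-n) + ((∑ k ∈ Finset.Ioo (-(n : ℤ)) n,
        sinMoment k * (a (M + k) + a (M - k) - 2 * a M)) / 2 +
        a M * ∑ k ∈ Finset.Ioo (-(n : ℤ)) n, sinMoment k)) := by
    have h1 : ∑ k ∈ Finset.Ico (-(n : ℤ)) n,
        a (M + k) * (sinMoment (M + k) - ccMoment n (M + k)) =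
        ∑ k ∈ Finset.Ico (-(n : ℤ)) n, (a (M + k) * sinMoment (M + k) -
          a (M + k) * sinMoment k) := by
      refine Finset.sum_congr rfl fun k hk => ?_
      rw [Finset.mem_Ico] at hk
      rw [hM, ccMoment_periodic hn, ccMoment_of_abs_le hn (abs_le.2 ⟨hk.1, hk.2.le⟩), mul_sub]
    rw [h1, Finset.sum_sub_distrib]
    congr 1
    rw [← Finset.Ioo_insert_left (by omega), Finset.sum_insert (by simp)]
    congr 1
    have h2 := sum_Ioo_neg_comm n fun k => a (M + k) * sinMoment k
    simp only [sinMoment_neg, ← sub_eq_add_neg] at h2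
    have h3 : ∑ k ∈ Finset.Ioo (-(n : ℤ)) n, sinMoment k * (a (M + k) + a (M - k) - 2 * a M) =
        ∑ k ∈ Finset.Ioo (-(n : ℤ)) n, a (M + k) * sinMoment k +
        ∑ k ∈ Finset.Ioo (-(n : ℤ)) n, a (M - k) * sinMoment k -
        2 * a M * ∑ k ∈ Finset.Ioo (-(n : ℤ)) n, sinMoment k := by
      rw [Finset.mul_sum, ← Finset.sum_add_distrib, ← Finset.sum_sub_distrib]
      exact Finset.sum_congr rfl fun k _ => by ring
    rw [h3, h2]
    ring
  have t1 : |∑ k ∈ Finset.Ico (-(n : ℤ)) n, a (M + k) * sinMoment (M + k)| ≤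
      2 * n * (A * (4 / x ^ 2)) := by
    refine (Finset.abs_sum_le_sum_abs _ _).trans ?_
    refine (Finset.sum_le_card_nsmul _ _ (A * (4 / x ^ 2)) fun k hk => ?_).trans ?_
    · rw [Finset.mem_Ico] at hk
      rw [abs_mul]
      exact mul_le_mul (hA _ (by omega)) (hlam _ (by omega)) (abs_nonneg _) hA0
    · rw [Int.card_Ico, nsmul_eq_mul, show ((n : ℤ) - -n).toNat = 2 * n by omega]
      push_cast
      exact le_rfl
  have t2 : |a (M + -n) * sinMoment (-n)| ≤ A * (4 / (n : ℝ) ^ 2) := by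
    rw [abs_mul, sinMoment_neg]
    refine mul_le_mul (hA _ (by omega)) ?_ (abs_nonneg _) hA0
    rw [le_div_iff₀ (by positivity)]
    exact_mod_cast abs_sinMoment_mul_sq_le n
  have t3 : |∑ k ∈ Finset.Ioo (-(n : ℤ)) n, sinMoment k * (a (M + k) + a (M - k) - 2 * a M)| ≤
      2 * n * (4 * η) := by
    refine (Finset.abs_sum_le_sum_abs _ _).trans ?_
    refine (Finset.sum_le_card_nsmul _ _ (4 * η) fun k hk => ?_).trans ?_
    · rw [Finset.mem_Ioo] at hk
      exact abs_sinMoment_mul_second_difference_le hη (abs_le.2 ⟨hk.1.le, hk.2.le⟩)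
    · rw [Int.card_Ioo, nsmul_eq_mul]
      have h0 : 0 ≤ 4 * η := by positivity
      refine mul_le_mul_of_nonneg_right ?_ h0
      have : ((n : ℤ) - -n - 1).toNat ≤ 2 * n := by omega
      exact_mod_cast this
  have t4 : |a M * ∑ k ∈ Finset.Ioo (-(n : ℤ)) n, sinMoment k| ≤ A * (4 / n) := by
    rw [abs_mul]
    exact mul_le_mul (hA _ (by omega)) (abs_sum_Ioo_sinMoment_le hn) (abs_nonneg _) hA0
  have hX : x ^ (-σ - 1) / n = (p : ℝ) ^ (-σ - 1) * (n : ℝ) ^ (-σ - 2) := by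
    rw [hx, Real.mul_rpow hp0.le hn0.le, mul_div_assoc, ← Real.rpow_sub_one hn0.ne']
    congr 2; ring
  have hX3 : x ^ (-σ - 3) = x ^ (-σ - 1) / x ^ 2 := by
    rw [← Real.rpow_natCast x 2, ← Real.rpow_sub hx0]
    congr 1; push_cast; ring
  have hnx : n / x ^ 2 ≤ 1 / (n : ℝ) := by
    rw [div_le_div_iff₀ (by positivity) hn0, hx, mul_pow]
    nlinarith [mul_le_mul_of_nonneg_right (one_le_pow₀ hp1 : (1 : ℝ) ≤ (p : ℝ) ^ 2) (sq_nonneg (n : ℝ))]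
  have hnn : 1 / (n : ℝ) ^ 2 ≤ 1 / n := by
    apply one_div_le_one_div_of_le hn0
    nlinarith
  have hY0 : 0 ≤ x ^ (-σ - 1) := by positivity
  have u1 : 2 * n * (A * (4 / x ^ 2)) ≤ 8 * C * (x ^ (-σ - 1) / n) := by
    calc _ = 8 * C * x ^ (-σ - 1) * (n / x ^ 2) := by simp only [A]; ring
      _ ≤ 8 * C * x ^ (-σ - 1) * (1 / n) := by gcongr
      _ = _ := by ring
  have u2 : A * (4 / (n : ℝ) ^ 2) ≤ 4 * C * (x ^ (-σ - 1) / n) := by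
    calc _ = 4 * C * x ^ (-σ - 1) * (1 / (n : ℝ) ^ 2) := by simp only [A]; ring
      _ ≤ 4 * C * x ^ (-σ - 1) * (1 / n) := by gcongr
      _ = _ := by ring
  have u3 : 2 * n * (4 * η) ≤ 8 * D * (x ^ (-σ - 1) / n) := by
    calc _ = 8 * D * x ^ (-σ - 1) * (n / x ^ 2) := by simp only [η, hX3]; ring
      _ ≤ 8 * D * x ^ (-σ - 1) * (1 / n) := by gcongr
      _ = _ := by ring
  have u4 : A * (4 / n) = 4 * C * (x ^ (-σ - 1) / n) := by simp only [A]; ring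
  rw [hsplit, ← hX]
  rw [abs_le] at *
  constructor <;> linarith [t1.1, t1.2, t2.1, t2.2, t3.1, t3.2, t4.1, t4.2]

theorem cosCoeff_neg (f : ℝ → ℝ) (m : ℤ) : cosCoeff f (-m) = cosCoeff f m := by
  simp only [cosCoeff, Int.cast_neg, neg_mul, Real.cos_neg]

theorem summable_cosCoeff {f : ℝ → ℝ} {C σ : ℝ} (hσ : 0 < σ)
    (ha : ∀ m : ℤ, 1 ≤ m → |cosCoeff f m| ≤ C * (m : ℝ) ^ (-σ - 1)) :
    Summable (cosCoeff f) := by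
  have h : Summable fun n : ℕ => cosCoeff f n := by
    refine (summable_nat_add_iff 1).1 (Summable.of_norm_bounded
      (g := fun n : ℕ => C * ((n + 1 : ℕ) : ℝ) ^ (-σ - 1)) ?_ fun n => ?_)
    · exact ((summable_nat_add_iff 1).2 (Real.summable_nat_rpow.2 (by linarith))).mul_left C
    · simpa using ha ((n + 1 : ℕ) : ℤ) (by omega)
  exact Summable.of_nat_of_neg h (by simpa only [cosCoeff_neg] using h)

theorem tendsto_sum_ccError {f : ℝ → ℝ} (hf : ContinuousOn f (Set.Icc (-1) 1))
    (hs : Summable (cosCoeff f)) {n : ℕ} (hn : 1 ≤ n) :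
    Tendsto (fun N : ℕ => ∑ k ∈ Finset.range N,
      2 / π * (cosCoeff f k * (sinMoment k - ccMoment n k))) atTop (nhds (ccError f n)) := by
  have h0 : sinMoment 0 - ccMoment n 0 = 0 := by
    rw [ccMoment_of_abs_le hn (by simp), sub_self]
  have h := (hasSum_ccError hf hs n).nat_add_neg
  simp only [cosCoeff_neg, sinMoment_neg, ccMoment_neg, h0, mul_zero, add_zero] at h
  convert h.tendsto_sum_nat using 4
  ring

theorem sum_range_odd_mul_eq {n : ℕ} (u : ℤ → ℝ) (h0 : ∀ k : ℕ, k < n → u k = 0) (P : ℕ) :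
    ∑ k ∈ Finset.range ((2 * P + 1) * n), u k =
      ∑ p ∈ Finset.range P, ∑ k ∈ Finset.Ico (-(n : ℤ)) n, u (2 * n * (p + 1 : ℕ) + k) := by
  induction P with
  | zero =>
    simpa using Finset.sum_eq_zero fun k hk => h0 k (Finset.mem_range.1 hk)
  | succ P ih =>
    rw [show (2 * (P + 1) + 1) * n = (2 * P + 1) * n + 2 * n by ring, Finset.sum_range_add, ih,
      Finset.sum_range_succ, ← sum_range_two_mul_sub n fun k => u (2 * n * (P + 1 : ℕ) + k)]
    congr 1
    refine Finset.sum_congr rfl fun i _ => ?_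
    congr 1
    push_cast
    ring

/-- Aliasing bound: coefficients decaying like `m ^ (-σ - 1)`, with second differences of step two
decaying like `m ^ (-σ - 3)`, give a Clenshaw–Curtis error of order `n ^ (-σ - 2)`. -/
theorem exists_abs_ccError_le {f : ℝ → ℝ} (hf : ContinuousOn f (Set.Icc (-1) 1)) {C D σ : ℝ}
    (hσ : 0 < σ) (ha : ∀ m : ℤ, 1 ≤ m → |cosCoeff f m| ≤ C * (m : ℝ) ^ (-σ - 1))
    (hd : ∀ m : ℤ, 1 ≤ m → |cosCoeff f (m + 2) - 2 * cosCoeff f m + cosCoeff f (m - 2)| ≤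
      D * (m : ℝ) ^ (-σ - 3)) :
    ∃ K, ∀ n : ℕ, 1 ≤ n → |ccError f n| ≤ K * (n : ℝ) ^ (-σ - 2) := by
  have hC : 0 ≤ C := by simpa using (abs_nonneg _).trans (ha 1 le_rfl)
  have hD : 0 ≤ D := by simpa using (abs_nonneg _).trans (hd 1 le_rfl)
  have hsum : Summable fun p : ℕ => ((p + 1 : ℕ) : ℝ) ^ (-σ - 1) :=
    (summable_nat_add_iff 1).2 (Real.summable_nat_rpow.2 (by linarith))
  refine ⟨2 / π * ((16 * C + 4 * D) * ∑' p : ℕ, ((p + 1 : ℕ) : ℝ) ^ (-σ - 1)), fun n hn => ?_⟩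
  have hodd : Tendsto (fun P : ℕ => (2 * P + 1) * n) atTop atTop :=
    tendsto_atTop_mono (fun P => show P ≤ _ by nlinarith [Nat.mul_le_mul_left P hn]) tendsto_id
  refine le_of_tendsto ((tendsto_sum_ccError hf (summable_cosCoeff hσ ha) hn).comp hodd).abs
    (Eventually.of_forall fun P => ?_)
  simp only [Function.comp_apply]
  rw [← Finset.mul_sum, sum_range_odd_mul_eq
    (fun k : ℤ => cosCoeff f k * (sinMoment k - ccMoment n k)) (fun k hk => by
      rw [ccMoment_of_abs_le hn (by simpa using hk.le), sub_self, mul_zero]), abs_mul,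
    abs_of_pos (by positivity : 0 < 2 / π), mul_assoc]
  gcongr
  calc _ ≤ ∑ p ∈ Finset.range P,
        (16 * C + 4 * D) * (((p + 1 : ℕ) : ℝ) ^ (-σ - 1) * (n : ℝ) ^ (-σ - 2)) :=
        (Finset.abs_sum_le_sum_abs _ _).trans
          (Finset.sum_le_sum fun p _ => abs_sum_block_le hσ ha hd hn (by omega))
    _ = (16 * C + 4 * D) * (∑ p ∈ Finset.range P, ((p + 1 : ℕ) : ℝ) ^ (-σ - 1)) *
        (n : ℝ) ^ (-σ - 2) := by
      rw [← Finset.mul_sum, ← Finset.sum_mul, mul_assoc]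
    _ ≤ _ := by
      gcongr
      exact hsum.sum_le_tsum _ fun p _ => by positivity

theorem cosCoeff_second_difference {f : ℝ → ℝ} (hf : ContinuousOn f (Set.Icc (-1) 1)) (m : ℤ) :
    cosCoeff f (m + 2) - 2 * cosCoeff f m + cosCoeff f (m - 2) =
      -4 * cosCoeff (fun x => (1 - x ^ 2) * f x) m := by
  have hi : ∀ l : ℤ, IntervalIntegrable (fun t => f (Real.cos t) * Real.cos (l * t))
      MeasureTheory.volume 0 π := fun l => by
    apply ContinuousOn.intervalIntegrable
    exact (hf.comp Real.continuous_cos.continuousOn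
      fun t _ => ⟨Real.neg_one_le_cos t, Real.cos_le_one t⟩).mul (by fun_prop)
  simp only [cosCoeff]
  rw [← intervalIntegral.integral_const_mul, ← intervalIntegral.integral_const_mul,
    ← intervalIntegral.integral_sub (hi _) ((hi _).const_mul 2),
    ← intervalIntegral.integral_add ((hi _).sub ((hi _).const_mul 2)) (hi _)]
  refine intervalIntegral.integral_congr fun t _ => ?_
  push_cast
  rw [add_mul, sub_mul, Real.cos_add, Real.cos_sub, Real.cos_two_mul]
  ring

theorem cosCoeff_algebraic_mul {α β : ℝ} (hα : 0 ≤ α) (hβ : 0 ≤ β) (g : ℝ → ℝ) (m : ℤ) :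
    cosCoeff (fun x => (1 - x ^ 2) * ((1 - x) ^ α * (1 + x) ^ β * g x)) m =
      cosCoeff (fun x => (1 - x) ^ (α + 1) * (1 + x) ^ (β + 1) * g x) m := by
  refine intervalIntegral.integral_congr fun t _ => ?_
  simp only
  rw [Real.rpow_add_one' (by linarith [Real.cos_le_one t]) (by linarith),
    Real.rpow_add_one' (by linarith [Real.neg_one_le_cos t]) (by linarith)]
  ring

theorem exists_intCast_eq_add_one_iff {x : ℝ} :
    (∃ i : ℤ, x + 1 = (i : ℝ)) ↔ ∃ i : ℤ, x = (i : ℝ) :=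
  ⟨fun ⟨i, h⟩ => ⟨i - 1, by push_cast; linarith⟩, fun ⟨i, h⟩ => ⟨i + 1, by push_cast; linarith⟩⟩

/-- For `f(x) = (1−x)^α (1+x)^β g(x)` with `α, β ≥ 0` not both integers and `g` smooth
on `[−1,1]`, with `s = 2min{α,β}` if neither `α` nor `β` is an integer, `s = 2α` if `β`
is an integer, `s = 2β` if `α` is an integer, the Clenshaw–Curtis error satisfies
`E_n^C[f] = O(n^{−s−2})`. -/
theorem ccError_algebraic_singularity (α β : ℝ) (hα : 0 ≤ α) (hβ : 0 ≤ β)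
    (hint : ¬((∃ i : ℤ, α = (i : ℝ)) ∧ (∃ i : ℤ, β = (i : ℝ))))
    (g : ℝ → ℝ) (hg : ContDiffOn ℝ (⊤ : ℕ∞) g (Set.Icc (-1) 1))
    (f : ℝ → ℝ) (hf : ∀ x, f x = (1 - x) ^ α * (1 + x) ^ β * g x)
    (s : ℝ)
    (hs1 : (¬(∃ i : ℤ, α = (i : ℝ)) ∧ ¬(∃ i : ℤ, β = (i : ℝ))) → s = 2 * min α β)
    (hs2 : (∃ i : ℤ, β = (i : ℝ)) → s = 2 * α)
    (hs3 : (∃ i : ℤ, α = (i : ℝ)) → s = 2 * β) :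
    (fun n : ℕ => ccError f n) =O[atTop] fun n : ℕ => (n : ℝ) ^ (-s - 2) := by
  obtain rfl : f = fun x => (1 - x) ^ α * (1 + x) ^ β * g x := funext hf
  have hpos : ∀ {x : ℝ}, 0 ≤ x → (¬∃ i : ℤ, x = (i : ℝ)) → 0 < x := fun hx h =>
    hx.lt_of_ne fun h0 => h ⟨0, by simpa using h0.symm⟩
  have hs : 0 < s := by
    by_cases hb : ∃ i : ℤ, β = (i : ℝ)
    · linarith [hs2 hb, hpos hα fun ha => hint ⟨ha, hb⟩]
    · by_cases ha : ∃ i : ℤ, α = (i : ℝ)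
      · linarith [hs3 ha, hpos hβ hb]
      · linarith [hs1 ⟨ha, hb⟩, lt_min (hpos hα ha) (hpos hβ hb)]
  have hcont : ContinuousOn (fun x : ℝ => (1 - x) ^ α * (1 + x) ^ β * g x) (Set.Icc (-1) 1) := by
    refine ContinuousOn.mul (Continuous.continuousOn ?_) hg.continuousOn
    exact ((continuous_const.sub continuous_id).rpow_const fun _ => Or.inr hα).mul
      ((continuous_const.add continuous_id).rpow_const fun _ => Or.inr hβ)
  obtain ⟨C, hC⟩ := exists_abs_cosCoeff_le hα hβ hg hs1 hs2 hs3
  obtain ⟨D, hD⟩ := exists_abs_cosCoeff_le (add_nonneg hα zero_le_one) (add_nonneg hβ zero_le_one)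
    hg (s := s + 2)
    (fun h => by
      rw [exists_intCast_eq_add_one_iff, exists_intCast_eq_add_one_iff] at h
      rw [hs1 h, min_add_add_right]
      ring)
    (fun h => by
      rw [exists_intCast_eq_add_one_iff] at h
      linarith [hs2 h])
    (fun h => by
      rw [exists_intCast_eq_add_one_iff] at h
      linarith [hs3 h])
  obtain ⟨K, hK⟩ := exists_abs_ccError_le hcont hs hC (D := 4 * D) fun m hm => by
    rw [cosCoeff_second_difference hcont, cosCoeff_algebraic_mul hα hβ, abs_mul]
    have := hD m hm
    rw [show -(s + 2) - 1 = -s - 3 by ring] at this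
    norm_num
    linarith
  refine Asymptotics.IsBigO.of_bound K (eventually_atTop.2 ⟨1, fun n hn => ?_⟩)
  rw [Real.norm_eq_abs, Real.norm_of_nonneg (by positivity)]
  exact hK n hn
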